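/- arXiv:math/0506200 — 4 statements merged into one kernel-verified Lean document; each statement's English description precedes it below -/
import Mathlib

section
/- Let d ≥ 2, let C ⊂ ℝ^d be a convex body, and let X be a finite packing set with at least one point. If X' is a packing set with |X'| = |X| and X' ⊆ interior(conv X), then λ(C,X') < λ(C,X). -/
open Metric Set Filter
open scoped RealInnerProductSpace Pointwise

noncomputable section

abbrev Euc (d : ℕ) := EuclideanSpace ℝ (Fin d)

/-- A packing set: distinct points are at distance at least 1. -/
def IsPackingSet {d : ℕ} (X : Set (Euc d)) : Prop :=
  X.Pairwise fun x y => 1 ≤ dist x y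

/-- A convex body: compact, convex, with nonempty interior. -/
def IsConvexBody {d : ℕ} (C : Set (Euc d)) : Prop :=
  Convex ℝ C ∧ IsCompact C ∧ (interior C).Nonempty

/-- A smooth convex body: through each boundary point there is a unique supporting
hyperplane, i.e. a unique outer unit normal. -/
def IsSmoothBody {d : ℕ} (C : Set (Euc d)) : Prop :=
  ∀ x ∈ frontier C, ∃! v : Euc d, ‖v‖ = 1 ∧ ∀ y ∈ C, ⟪v, y⟫ ≤ ⟪v, x⟫

/-- λ(C,X): the least λ > 0 such that a translate of X + (1/2)Bᵈ fits in λC. -/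
def containerScale {d : ℕ} (C X : Set (Euc d)) : ℝ :=
  sInf {l : ℝ | 0 < l ∧ ∃ t : Euc d, ∀ x ∈ X, closedBall (t + x) (1 / 2) ⊆ l • C}

/-- λ(C,n): the minimum of λ(C,X) over packing sets X of cardinality n. -/
def containerMin {d : ℕ} (C : Set (Euc d)) (n : ℕ) : ℝ :=
  sInf {r : ℝ | ∃ X : Set (Euc d), IsPackingSet X ∧ X.Finite ∧ X.ncard = n ∧
    containerScale C X = r}

/-- X attains λ(C,n). -/
def AttainsContainerMin {d : ℕ} (C X : Set (Euc d)) (n : ℕ) : Prop :=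
  IsPackingSet X ∧ X.Finite ∧ X.ncard = n ∧ containerScale C X = containerMin C n

/-- N_X(x): points of X at distance exactly 1 from x. -/
def neighbors {d : ℕ} (X : Set (Euc d)) (x : Euc d) : Set (Euc d) :=
  {y ∈ X | dist x y = 1}

/-- The difference set of a family F under a choice of isometries I. -/
def lcDiffSet {d : ℕ} (F : Set (Set (Euc d))) (I : Set (Euc d) → (Euc d ≃ᵢ Euc d)) :
    Set (Euc d) :=
  {z | ∃ X ∈ F, ∃ x ∈ X, ∃ y ∈ X, z = I X x - I X y}

/-- Condition (i) of limited complexity. -/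
def LCCondI {d : ℕ} (F : Set (Set (Euc d))) : Prop :=
  ∃ I : Set (Euc d) → (Euc d ≃ᵢ Euc d),
    ∀ R : ℝ, 0 < R →
      {p ∈ closedBall (0 : Euc d) R | AccPt p (𝓟 (lcDiffSet F I))}.Finite

/-- Condition (ii) of limited complexity with constant ρ. -/
def LCCondII {d : ℕ} (F : Set (Set (Euc d))) (ρ : ℝ) : Prop :=
  ∀ X ∈ F, ∀ x ∈ X, ∀ S ⊆ neighbors X x, S.Nonempty →
    x ∈ affineSpan ℝ S ∨ ρ < infDist x (affineSpan ℝ S : Set (Euc d))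

/-- A family of packing sets of limited complexity. -/
def IsLCFamily {d : ℕ} (F : Set (Set (Euc d))) : Prop :=
  (∀ X ∈ F, IsPackingSet X) ∧ LCCondI F ∧ ∃ ρ > 0, LCCondII F ρ

/-- A lattice: a discrete additive subgroup. -/
def IsLattice {d : ℕ} (L : AddSubgroup (Euc d)) : Prop :=
  ∃ ε > 0, ∀ x ∈ L, x ≠ 0 → ε ≤ ‖x‖

/-- A lattice packing set: a packing set isometric to a subset of some lattice. -/
def IsLatticePackingSet {d : ℕ} (X : Set (Euc d)) : Prop :=
  IsPackingSet X ∧ ∃ (f : Euc d ≃ᵢ Euc d) (L : AddSubgroup (Euc d)),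
    IsLattice L ∧ f '' X ⊆ (L : Set (Euc d))

/-- The scales `l` for which a translate of `X + (1/2)Bᵈ` fits in `l • C`. -/
def admissibleScales {d : ℕ} (C X : Set (Euc d)) : Set ℝ :=
  {l : ℝ | 0 < l ∧ ∃ t : Euc d, ∀ x ∈ X, closedBall (t + x) (1 / 2) ⊆ l • C}

lemma admissibleScales_nonempty {d : ℕ} {C X : Set (Euc d)} (hC : (interior C).Nonempty)
    (hX : Bornology.IsBounded X) : (admissibleScales C X).Nonempty := by
  obtain ⟨c, hc⟩ := hC
  obtain ⟨r, hr, hrC⟩ := Metric.isOpen_iff.1 isOpen_interior c hc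
  obtain ⟨M, hM, hXM⟩ := hX.exists_pos_norm_le
  have hl : 0 < (M + 1) / r := by positivity
  refine ⟨(M + 1) / r, hl, ((M + 1) / r) • c, fun x hx z hz => ?_⟩
  rw [Set.mem_smul_set_iff_inv_smul_mem₀ hl.ne']
  refine interior_subset (hrC ?_)
  rw [mem_closedBall, dist_eq_norm] at hz
  have hbound : ‖z - ((M + 1) / r) • c‖ < M + 1 := by
    have hsplit : z - ((M + 1) / r) • c = (z - (((M + 1) / r) • c + x)) + x := by abel
    rw [hsplit]
    linarith [norm_add_le (z - (((M + 1) / r) • c + x)) x, hXM x hx]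
  have hscale : ((M + 1) / r)⁻¹ • z - c = ((M + 1) / r)⁻¹ • (z - ((M + 1) / r) • c) := by
    rw [smul_sub, inv_smul_smul₀ hl.ne']
  rw [mem_ball, dist_eq_norm, hscale, norm_smul, Real.norm_of_nonneg (inv_nonneg.2 hl.le),
    inv_mul_lt_iff₀ hl, div_mul_cancel₀ _ hr.ne']
  exact hbound

lemma containerScale_pos {d : ℕ} (hd : 0 < d) {C X : Set (Euc d)}
    (hC : Bornology.IsBounded C) (hX : X.Nonempty) (hne : (admissibleScales C X).Nonempty) :
    0 < containerScale C X := by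
  obtain ⟨R, hR, hCR⟩ := hC.exists_pos_norm_le
  obtain ⟨x, hx⟩ := hX
  refine lt_of_lt_of_le (b := 1 / (2 * R)) (by positivity) (le_csInf hne ?_)
  rintro l ⟨hl, t, ht⟩
  have hnorm : ∀ z ∈ l • C, ‖z‖ ≤ l * R := by
    rintro _ ⟨c, hc, rfl⟩
    simp only [norm_smul, Real.norm_of_nonneg hl.le]
    exact mul_le_mul_of_nonneg_left (hCR c hc) hl.le
  let e : Euc d := EuclideanSpace.single ⟨0, hd⟩ 1
  have he : ‖e‖ = 1 := by simp [e]
  have hadd := hnorm _ (ht x hx (show t + x + (1 / 2 : ℝ) • e ∈ _ by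
    simp [mem_closedBall, norm_smul, he]))
  have hsub := hnorm _ (ht x hx (show t + x - (1 / 2 : ℝ) • e ∈ _ by
    simp [mem_closedBall, norm_smul, he]))
  have hdiff : (t + x + (1 / 2 : ℝ) • e) - (t + x - (1 / 2 : ℝ) • e) = e := by module
  have hle := norm_sub_le (t + x + (1 / 2 : ℝ) • e) (t + x - (1 / 2 : ℝ) • e)
  rw [hdiff, he] at hle
  rw [div_le_iff₀ (by positivity)]
  linarith

/-- If the closed `ε`-balls around the points of `X'` lie in the convex hull of `X`, then every
scale admissible for `X` can be shrunk by a fixed factor to one admissible for `X'`. -/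
lemma smul_mem_admissibleScales {d : ℕ} {C X X' : Set (Euc d)} (hC : Convex ℝ C) {ε M : ℝ}
    (hε : 0 < ε) (hM : 0 < M) (hX'M : ∀ x ∈ X', ‖x‖ + 1 / 2 ≤ M)
    (hsub : ∀ x ∈ X', closedBall x ε ⊆ convexHull ℝ X) {l : ℝ} (hl : l ∈ admissibleScales C X) :
    (1 + ε / M)⁻¹ * l ∈ admissibleScales C X' := by
  obtain ⟨hl0, t, ht⟩ := hl
  have hk : 0 < 1 + ε / M := by positivity
  refine ⟨by positivity, (1 + ε / M)⁻¹ • t, fun x hx z hz => ?_⟩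
  obtain ⟨u, rfl⟩ : ∃ u, z = (1 + ε / M)⁻¹ • t + x + u := ⟨_, (add_sub_cancel _ z).symm⟩
  have hu : ‖u‖ ≤ 1 / 2 := by simpa [mem_closedBall, dist_eq_norm] using hz
  have hhull : convexHull ℝ X ⊆ {p | p + (t + u) ∈ l • C} := by
    refine convexHull_min (fun y hy => ht y hy ?_) ((hC.smul l).translate_preimage_left (t + u))
    have hyu : y + (t + u) - (t + y) = u := by abel
    rwa [mem_closedBall, dist_eq_norm, hyu]
  have hp : x + (ε / M) • (x + u) ∈ convexHull ℝ X := by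
    refine hsub x hx ?_
    rw [mem_closedBall, dist_eq_norm, add_sub_cancel_left, norm_smul,
      Real.norm_of_nonneg (by positivity)]
    calc ε / M * ‖x + u‖ ≤ ε / M * M := by
          gcongr
          linarith [norm_add_le x u, hX'M x hx]
      _ = ε := div_mul_cancel₀ _ hM.ne'
  have hdilate : (1 + ε / M)⁻¹ • t + x + u =
      (1 + ε / M)⁻¹ • (x + (ε / M) • (x + u) + (t + u)) := by
    rw [eq_inv_smul_iff₀ hk.ne', smul_add, smul_add, smul_inv_smul₀ hk.ne']
    module
  rw [mul_smul, hdilate]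
  exact Set.smul_mem_smul_set (hhull hp)

/-- If `X'` is a packing set of the same cardinality as a nonempty finite
packing set `X` with `X' ⊆ interior (conv X)`, then `λ(C,X') < λ(C,X)`. -/
theorem containerScale_lt_of_subset_interior_convexHull
    (d : ℕ) (hd : 2 ≤ d) (C : Set (Euc d)) (hC : IsConvexBody C)
    (X : Set (Euc d)) (hXpack : IsPackingSet X) (hXfin : X.Finite) (hXne : X.Nonempty)
    (X' : Set (Euc d)) (hX'pack : IsPackingSet X') (hX'fin : X'.Finite)
    (hcard : X'.ncard = X.ncard) (hsub : X' ⊆ interior (convexHull ℝ X)) :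
    containerScale C X' < containerScale C X := by
  obtain ⟨hconv, hcomp, hint⟩ := hC
  obtain ⟨ε, hε, hεsub⟩ :=
    hX'fin.isCompact.exists_cthickening_subset_open isOpen_interior hsub
  obtain ⟨M, hM, hX'M⟩ := hX'fin.isBounded.exists_pos_norm_le
  have hne := admissibleScales_nonempty hint hXfin.isBounded
  have hpos := containerScale_pos (by omega) hcomp.isBounded hXne hne
  have hk : 1 < 1 + ε / (M + 1 / 2) := lt_add_of_pos_right _ (by positivity)
  have hk0 := zero_lt_one.trans hk
  have hle : (1 + ε / (M + 1 / 2)) * containerScale C X' ≤ containerScale C X := by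
    refine le_csInf hne fun l hl => ?_
    rw [← le_inv_mul_iff₀ hk0]
    refine csInf_le ⟨0, fun _ h => h.1.le⟩ ?_
    exact smul_mem_admissibleScales hconv hε (by positivity)
      (fun x hx => by linarith [hX'M x hx])
      (fun x hx => (closedBall_subset_cthickening hx ε).trans (hεsub.trans interior_subset)) hl
  by_contra! h
  nlinarith
end
end

section
/- Let d ≥ 2, let X ⊆ ℝ^d be a packing set, and let x ∈ X with N_X(x) ≠ ∅. If x is not contained in the interior of conv(N_X(x)), then there exist a unit vector v ∈ S^{d−1} and δ₀ > 0 such that for every δ with 0 < δ ≤ δ₀, the set X' = (X∖{x}) ∪ {x + δv} is a packing set and |x + δv − y| > 1 for all y ∈ X∖{x}; i.e., x can be moved to a free position. -/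
open Metric Set Filter
open scoped RealInnerProductSpace Pointwise

noncomputable section

/-- A point outside the interior of a nonempty convex set in a finite-dimensional inner product
space is weakly separated from the set by a unit vector. -/
theorem Convex.exists_norm_eq_one_inner_le_of_notMem_interior {E : Type*} [NormedAddCommGroup E]
    [InnerProductSpace ℝ E] [FiniteDimensional ℝ E] {s : Set E}
    (hs : Convex ℝ s) (hne : s.Nonempty) {x : E} (hx : x ∉ interior s) :
    ∃ v : E, ‖v‖ = 1 ∧ ∀ y ∈ s, ⟪v, y⟫ ≤ ⟪v, x⟫ := by
  suffices h : ∃ v : E, v ≠ 0 ∧ ∀ y ∈ s, ⟪v, y⟫ ≤ ⟪v, x⟫ by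
    obtain ⟨v, hv, hvs⟩ := h
    refine ⟨‖v‖⁻¹ • v, norm_smul_inv_norm hv, fun y hy => ?_⟩
    simp only [real_inner_smul_left]
    exact mul_le_mul_of_nonneg_left (hvs y hy) (by positivity)
  by_cases hint : (interior s).Nonempty
  · obtain ⟨f, hf, hfs⟩ := geometric_hahn_banach_of_nonempty_interior_point hs hx hint
    refine ⟨(InnerProductSpace.toDual ℝ E).symm f, by simpa using hf, fun y hy => ?_⟩
    simpa only [InnerProductSpace.toDual_symm_apply] using hfs y hy
  · rw [hs.interior_nonempty_iff_affineSpan_eq_top,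
      AffineSubspace.affineSpan_eq_top_iff_vectorSpan_eq_top_of_nonempty ℝ E E hne,
      ← Submodule.orthogonal_eq_bot_iff] at hint
    obtain ⟨w, hw, hw0⟩ := Submodule.exists_mem_ne_zero_of_ne_bot hint
    obtain ⟨z, hz⟩ := hne
    have hwz : ∀ y ∈ s, ⟪w, y⟫ = ⟪w, z⟫ := fun y hy => by
      rw [← sub_eq_zero, ← inner_sub_right]
      exact (Submodule.mem_orthogonal' _ w).1 hw _ (vsub_mem_vectorSpan ℝ hy hz)
    rcases le_total ⟪w, z⟫ ⟪w, x⟫ with h | h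
    · exact ⟨w, hw0, fun y hy => (hwz y hy).trans_le h⟩
    · refine ⟨-w, neg_ne_zero.2 hw0, fun y hy => ?_⟩
      rw [inner_neg_left, inner_neg_left, hwz y hy]
      exact neg_le_neg h

/-- The points of a packing set that neither coincide with nor touch `x` are uniformly bounded
away from the unit sphere around `x`. -/
theorem IsPackingSet.exists_one_lt_le_dist {d : ℕ} {X : Set (Euc d)} (hX : IsPackingSet X)
    {x : Euc d} (hx : x ∈ X) :
    ∃ r : ℝ, 1 < r ∧ ∀ y ∈ X \ {x}, y ∉ neighbors X x → r ≤ dist x y := by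
  set A := (X \ {x}) \ neighbors X x with hA
  rcases A.eq_empty_or_nonempty with h | h
  · exact ⟨2, one_lt_two, fun y hy hyN => (h.subset ⟨hy, hyN⟩).elim⟩
  · have hclosed : IsClosed A :=
      isClosed_of_pairwise_le_dist one_pos (hX.mono fun y hy => hy.1.1)
    obtain ⟨z, hz, hzd⟩ := hclosed.exists_infDist_eq_dist h x
    refine ⟨dist x z, ?_, fun y hy hyN => hzd ▸ infDist_le_dist_of_mem ⟨hy, hyN⟩⟩
    exact lt_of_le_of_ne (hX hx hz.1.1 (Ne.symm hz.1.2)) fun h => hz.2 ⟨hz.1.1, h.symm⟩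

/-- Replacing a point of a packing set by a point at distance at least 1 from all the others
gives a packing set. -/
theorem IsPackingSet.diff_union_singleton {d : ℕ} {X : Set (Euc d)} (hX : IsPackingSet X)
    {x z : Euc d} (hz : ∀ y ∈ X \ {x}, 1 ≤ dist z y) : IsPackingSet ((X \ {x}) ∪ {z}) := by
  rw [union_singleton]
  exact (hX.mono sdiff_subset).insert fun y hy _ => ⟨hz y hy, dist_comm z y ▸ hz y hy⟩

/-- Moving away from a point, along a direction making a non-acute angle with it, strictly
increases the distance. -/
theorem dist_lt_dist_add_smul {E : Type*} [NormedAddCommGroup E] [InnerProductSpace ℝ E]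
    {x y v : E} (hv : v ≠ 0) (hvy : ⟪v, y⟫ ≤ ⟪v, x⟫) {δ : ℝ} (hδ : 0 < δ) :
    dist x y < dist (x + δ • v) y := by
  have h : 0 ≤ ⟪x - y, δ • v⟫ := by
    rw [real_inner_smul_right, real_inner_comm, inner_sub_right]
    exact mul_nonneg hδ.le (sub_nonneg.2 hvy)
  have hpos : 0 < ‖δ • v‖ := norm_pos_iff.2 (smul_ne_zero hδ.ne' hv)
  rw [dist_eq_norm, dist_eq_norm, add_sub_right_comm]
  refine lt_of_pow_lt_pow_left₀ 2 (norm_nonneg _) ?_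
  rw [norm_add_sq_real]
  nlinarith

/-- If `x ∈ X` has `N_X(x) ≠ ∅` but `x` is not in the interior of
`conv (N_X(x))`, then `x` can be moved to a free position: there are a unit vector `v`
and `δ₀ > 0` such that for all `0 < δ ≤ δ₀`, replacing `x` by `x + δv` yields a packing
set in which `x + δv` is at distance `> 1` from all other points. -/
theorem move_to_free_position_of_not_mem_interior_convexHull_neighbors
    (d : ℕ) (hd : 2 ≤ d) (X : Set (Euc d)) (hX : IsPackingSet X)
    (x : Euc d) (hx : x ∈ X) (hN : (neighbors X x).Nonempty)
    (hxnot : x ∉ interior (convexHull ℝ (neighbors X x))) :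
    ∃ v : Euc d, ‖v‖ = 1 ∧ ∃ δ₀ : ℝ, 0 < δ₀ ∧ ∀ δ : ℝ, 0 < δ → δ ≤ δ₀ →
      IsPackingSet ((X \ {x}) ∪ {x + δ • v}) ∧
      ∀ y ∈ X \ {x}, 1 < dist (x + δ • v) y := by
  obtain ⟨v, hv, hvN⟩ := (convex_convexHull ℝ _).exists_norm_eq_one_inner_le_of_notMem_interior
    hN.convexHull hxnot
  obtain ⟨r, hr, hrX⟩ := hX.exists_one_lt_le_dist hx
  refine ⟨v, hv, (r - 1) / 2, by linarith, fun δ hδ hδr => ?_⟩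
  have hfree : ∀ y ∈ X \ {x}, 1 < dist (x + δ • v) y := by
    intro y hy
    by_cases hyN : y ∈ neighbors X x
    · calc 1 = dist x y := hyN.2.symm
        _ < dist (x + δ • v) y :=
          dist_lt_dist_add_smul (norm_pos_iff.1 (hv ▸ one_pos))
            (hvN y (subset_convexHull ℝ _ hyN)) hδ
    · have hmove : dist x (x + δ • v) = δ := by
        rw [dist_self_add_right, norm_smul, hv, mul_one, Real.norm_of_nonneg hδ.le]
      linarith [hrX y hy hyN, dist_triangle x (x + δ • v) y]
  exact ⟨hX.diff_union_singleton fun y hy => (hfree y hy).le, hfree⟩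
end
end

section
/- Let L = ℤ·(1,0) + ℤ·(1/2, √3/2) be the hexagonal lattice in ℝ². Then for every X ⊆ L, every x ∈ X, and every nonempty finite subset S ⊆ N_X(x), the affine subspace spanned by S either contains x or has distance at least 1/2 from x. In particular, the family of all packing sets isometric to a subset of L satisfies condition (ii) of limited complexity for every ρ < 1/2. -/
open Metric Set Filter
open scoped RealInnerProductSpace Pointwise

noncomputable section

/-- The point of `ℝ²` with the given coordinates. -/
def pt2 (a b : ℝ) : Euc 2 := (WithLp.equiv 2 (Fin 2 → ℝ)).symm ![a, b]

/-- The hexagonal lattice `L = ℤ·(1,0) + ℤ·(1/2,√3/2)` in `ℝ²`. -/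
def hexLattice : Set (Euc 2) :=
  {z | ∃ a b : ℤ, z = a • pt2 1 0 + b • pt2 (1 / 2) (Real.sqrt 3 / 2)}

theorem euc_two_dist_sq (y z : Euc 2) :
    dist y z ^ 2 = (y 0 - z 0) ^ 2 + (y 1 - z 1) ^ 2 := by
  rw [EuclideanSpace.dist_eq, Real.sq_sqrt (by positivity), Fin.sum_univ_two,
    Real.dist_eq, Real.dist_eq, sq_abs, sq_abs]

/-- Three points not on a common line affinely span the plane. -/
theorem mem_affineSpan_of_det_ne_zero {S : Set (Euc 2)} {u v w : Euc 2}
    (hu : u ∈ S) (hv : v ∈ S) (hw : w ∈ S)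
    (hD : (v 0 - u 0) * (w 1 - u 1) - (v 1 - u 1) * (w 0 - u 0) ≠ 0) (x : Euc 2) :
    x ∈ affineSpan ℝ S := by
  set D := (v 0 - u 0) * (w 1 - u 1) - (v 1 - u 1) * (w 0 - u 0) with hDdef
  have mu := subset_affineSpan ℝ S hu
  have mv := subset_affineSpan ℝ S hv
  have mw := subset_affineSpan ℝ S hw
  have key := AffineSubspace.smul_vsub_vadd_mem _
    (((v 0 - u 0) * (x 1 - u 1) - (v 1 - u 1) * (x 0 - u 0)) / D) mw mu
    (AffineSubspace.smul_vsub_vadd_mem _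
      (((x 0 - u 0) * (w 1 - u 1) - (x 1 - u 1) * (w 0 - u 0)) / D) mv mu mu)
  convert key using 1
  ext i
  fin_cases i <;> simp <;> field_simp <;> rw [hDdef] <;> ring

/-- If the points of `S` lie at distance `1` from `x` and have integral squared mutual
distances, then the affine span of `S` contains `x` or stays at distance `1 / 2` from `x`. -/
theorem mem_affineSpan_or_half_le_infDist {S : Set (Euc 2)} {x : Euc 2}
    (hne : S.Nonempty) (hunit : ∀ y ∈ S, dist x y = 1)
    (hint : ∀ y ∈ S, ∀ z ∈ S, ∃ k : ℤ, dist y z ^ 2 = k) :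
    x ∈ affineSpan ℝ S ∨ 1 / 2 ≤ infDist x (affineSpan ℝ S : Set (Euc 2)) := by
  rw [or_iff_not_imp_left]
  intro hx
  obtain ⟨u, hu⟩ := hne
  have mu := subset_affineSpan ℝ S hu
  rw [le_infDist ⟨u, mu⟩]
  intro p hp
  by_cases hsingle : ∀ v ∈ S, v = u
  · rw [Set.eq_singleton_iff_unique_mem.2 ⟨hu, hsingle⟩, AffineSubspace.coe_affineSpan_singleton,
      Set.mem_singleton_iff] at hp
    rw [hp, hunit u hu]
    norm_num
  push Not at hsingle
  obtain ⟨v, hv, hvu⟩ := hsingle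
  have hline : ∀ w ∈ S, (v 0 - u 0) * (w 1 - u 1) - (v 1 - u 1) * (w 0 - u 0) = 0 := by
    intro w hw
    by_contra hD
    exact hx (mem_affineSpan_of_det_ne_zero hu hv hw hD x)
  have hpline : (v 0 - u 0) * (p 1 - u 1) - (v 1 - u 1) * (p 0 - u 0) = 0 := by
    refine affineSpan_induction
      (p := fun q : Euc 2 => (v 0 - u 0) * (q 1 - u 1) - (v 1 - u 1) * (q 0 - u 0) = 0)
      hp hline ?_
    intro c q r s hq hr hs
    simp only [vsub_eq_sub, vadd_eq_add, PiLp.add_apply, PiLp.smul_apply, PiLp.sub_apply,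
      smul_eq_mul]
    linear_combination c * hq - c * hr + hs
  obtain ⟨k, hk⟩ := hint u hu v hv
  have hk_pos : 0 < dist u v ^ 2 := pow_pos (dist_pos.2 hvu.symm) 2
  have hxu := euc_two_dist_sq x u
  have hxv := euc_two_dist_sq x v
  have huv := euc_two_dist_sq u v
  have hxp := euc_two_dist_sq x p
  rw [hunit u hu] at hxu
  rw [hunit v hv] at hxv
  have hk_le : k ≤ 3 := by
    by_contra! hk4
    have hk4' : (4 : ℝ) ≤ k := by exact_mod_cast hk4
    have hsum : (u 0 + v 0 - 2 * x 0) ^ 2 + (u 1 + v 1 - 2 * x 1) ^ 2 ≤ 0 := by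
      linarith
    have h0 : u 0 + v 0 - 2 * x 0 = 0 :=
      pow_eq_zero_iff two_ne_zero |>.1 <| le_antisymm
        (by linarith [sq_nonneg (u 1 + v 1 - 2 * x 1)]) (sq_nonneg _)
    have h1 : u 1 + v 1 - 2 * x 1 = 0 :=
      pow_eq_zero_iff two_ne_zero |>.1 <| le_antisymm
        (by linarith [sq_nonneg (u 0 + v 0 - 2 * x 0)]) (sq_nonneg _)
    apply hx
    convert AffineSubspace.smul_vsub_vadd_mem _ (1 / 2 : ℝ) (subset_affineSpan ℝ S hv) mu mu
      using 1
    ext i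
    fin_cases i <;> simp <;> linarith
  have hk_le' : (k : ℝ) ≤ 3 := by exact_mod_cast hk_le
  have hcross : (v 0 - u 0) * (p 1 - x 1) - (v 1 - u 1) * (p 0 - x 0) =
      (v 0 - u 0) * (u 1 - x 1) - (v 1 - u 1) * (u 0 - x 0) := by
    linear_combination hpline
  -- The distance formula: `k * dist x p ^ 2` dominates the squared cross product.
  have hcs : ((v 0 - u 0) * (p 1 - x 1) - (v 1 - u 1) * (p 0 - x 0)) ^ 2 ≤
      k * dist x p ^ 2 := by
    rw [← hk, huv, hxp]
    linarith [sq_nonneg ((v 0 - u 0) * (p 0 - x 0) + (v 1 - u 1) * (p 1 - x 1))]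
  have hinner : (v 0 - u 0) * (u 0 - x 0) + (v 1 - u 1) * (u 1 - x 1) = -(k / 2 : ℝ) := by
    rw [← hk, huv]
    linear_combination (hxu - hxv) / 2
  have hlag : ((v 0 - u 0) * (u 1 - x 1) - (v 1 - u 1) * (u 0 - x 0)) ^ 2 +
      (k / 2 : ℝ) ^ 2 = k := by
    calc _ = ((v 0 - u 0) * (u 1 - x 1) - (v 1 - u 1) * (u 0 - x 0)) ^ 2 +
          ((v 0 - u 0) * (u 0 - x 0) + (v 1 - u 1) * (u 1 - x 1)) ^ 2 := by
          rw [hinner, neg_sq]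
      _ = ((u 0 - v 0) ^ 2 + (u 1 - v 1) ^ 2) * ((x 0 - u 0) ^ 2 + (x 1 - u 1) ^ 2) := by ring
      _ = k := by rw [← hxu, ← huv, hk, one_pow, mul_one]
  rw [hcross] at hcs
  have hk0 : (0 : ℝ) < k := hk ▸ hk_pos
  have hmid : 1 / 4 ≤ dist x p ^ 2 := by
    refine le_of_mul_le_mul_left ?_ hk0
    linarith [mul_nonneg hk0.le (sub_nonneg.2 hk_le')]
  refine (sq_le_sq₀ (by norm_num) dist_nonneg).1 ?_
  linarith

theorem hexLattice_dist_sq_eq_int {y z : Euc 2} (hy : y ∈ hexLattice) (hz : z ∈ hexLattice) :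
    ∃ k : ℤ, dist y z ^ 2 = k := by
  obtain ⟨a, b, rfl⟩ := hy
  obtain ⟨c, d, rfl⟩ := hz
  refine ⟨(a - c) ^ 2 + (a - c) * (b - d) + (b - d) ^ 2, ?_⟩
  have h3 : Real.sqrt 3 ^ 2 = 3 := Real.sq_sqrt (by norm_num)
  rw [euc_two_dist_sq]
  simp [pt2]
  linear_combination ((b : ℝ) - d) ^ 2 / 4 * h3

/-- For any `X ⊆ L` (`L` the hexagonal lattice), `x ∈ X`, and nonempty
finite `S ⊆ N_X(x)`, the affine span of `S` contains `x` or has distance at least `1/2`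
from `x`. In particular, the family of all packing sets isometric to a subset of `L`
satisfies condition (ii) of limited complexity for every `ρ < 1/2`. -/
theorem hexLattice_limited_complexity_condII :
    (∀ X ⊆ hexLattice, ∀ x ∈ X, ∀ S ⊆ neighbors X x, S.Nonempty → S.Finite →
      x ∈ affineSpan ℝ S ∨ 1 / 2 ≤ infDist x (affineSpan ℝ S : Set (Euc 2))) ∧
    ∀ ρ : ℝ, ρ < 1 / 2 →
      LCCondII {X : Set (Euc 2) | ∃ f : Euc 2 ≃ᵢ Euc 2, f '' X ⊆ hexLattice} ρ := by
  have hex_nbr : ∀ (X : Set (Euc 2)) (f : Euc 2 ≃ᵢ Euc 2), f '' X ⊆ hexLattice → ∀ x : Euc 2,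
      ∀ S ⊆ neighbors X x, S.Nonempty →
      x ∈ affineSpan ℝ S ∨ 1 / 2 ≤ infDist x (affineSpan ℝ S : Set (Euc 2)) := by
    intro X f hf x S hS hne
    refine mem_affineSpan_or_half_le_infDist hne (fun y hy => (hS hy).2) fun y hy z hz => ?_
    rw [← f.dist_eq]
    exact hexLattice_dist_sq_eq_int (hf ⟨y, (hS hy).1, rfl⟩) (hf ⟨z, (hS hz).1, rfl⟩)
  refine ⟨fun X hX x _ S hS hne _ => hex_nbr X (IsometryEquiv.refl _) ?_ x S hS hne, ?_⟩
  · rintro _ ⟨y, hy, rfl⟩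
    exact hX hy
  · rintro ρ hρ X ⟨f, hf⟩ x _ S hS hne
    exact (hex_nbr X f hf x S hS hne).imp_right hρ.trans_le
end
end

section
/- Let d ≥ 2 and let Λ ⊆ ℝ^d be a lattice in which any two distinct points have distance at least 1. Then the family F of all packing sets that are isometric to a subset of Λ is of limited complexity; moreover, the isometries in condition (i) can be chosen so that the difference set {x − y : x, y ∈ I_X(X), X ∈ F} is finite in any bounded region. -/
open Metric Set Filter
open scoped RealInnerProductSpace Pointwise

noncomputable section

/-- A uniformly discrete additive subgroup has finite intersection with every closed ball. -/
lemma IsLattice.finite_inter_closedBall {d : ℕ} {L : AddSubgroup (Euc d)} (hL : IsLattice L)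
    (R : ℝ) : ((L : Set (Euc d)) ∩ closedBall 0 R).Finite := by
  obtain ⟨ε, hε, h⟩ := hL
  have hdisc : DiscreteTopology L := DiscreteTopology.of_forall_le_norm hε fun x hx =>
    h x x.2 fun h0 => hx (Subtype.ext h0)
  have hclosed : IsClosed (L : Set (Euc d)) := AddSubgroup.isClosed_of_discrete
  rw [inter_comm]
  exact Metric.finite_isBounded_inter_isClosed ⟨hdisc⟩ isBounded_closedBall hclosed

/-- A set which is finite in every ball has no accumulation points. -/
lemma not_accPt_of_finite_inter_closedBall {E : Type*} [NormedAddCommGroup E] {D : Set E}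
    (hD : ∀ R : ℝ, 0 < R → (D ∩ closedBall 0 R).Finite) (p : E) : ¬ AccPt p (𝓟 D) := by
  intro hp
  have hU : closedBall (0 : E) (‖p‖ + 1) ∈ nhds p :=
    mem_of_superset (ball_mem_nhds p one_pos) fun y hy => by
      rw [mem_ball_iff_norm] at hy
      rw [mem_closedBall_zero_iff]
      linarith [norm_le_norm_add_norm_sub p y, norm_sub_rev p y]
  have hfin := hD (‖p‖ + 1) (by positivity)
  rw [inter_comm] at hfin
  exact (Set.Infinite.of_accPt (hp.nhds_inter hU)) hfin

/-- The affine subspaces spanned by subsets of a finite set `V` and missing a point `x`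
stay uniformly away from `x`. -/
lemma exists_pos_forall_lt_infDist_affineSpan {E : Type*} [NormedAddCommGroup E]
    [NormedSpace ℝ E] [FiniteDimensional ℝ E] {V : Set E} (hV : V.Finite) (x : E) :
    ∃ ρ > 0, ∀ T ⊆ V, T.Nonempty →
      x ∈ affineSpan ℝ T ∨ ρ < infDist x (affineSpan ℝ T : Set E) := by
  have key : ∀ᶠ ρ : ℝ in nhdsWithin 0 (Ioi 0), ∀ T ∈ {T | T ⊆ V}, T.Nonempty →
      x ∈ affineSpan ℝ T ∨ ρ < infDist x (affineSpan ℝ T : Set E) := by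
    rw [eventually_all_finite hV.finite_subsets]
    intro T _
    by_cases hx : T.Nonempty ∧ x ∉ affineSpan ℝ T
    · have hclosed : IsClosed (affineSpan ℝ T : Set E) :=
        AffineSubspace.closed_of_finiteDimensional _
      have hpos : 0 < infDist x (affineSpan ℝ T : Set E) :=
        (hclosed.notMem_iff_infDist_pos ((affineSpan_nonempty ℝ).2 hx.1)).1 hx.2
      filter_upwards [nhdsWithin_le_nhds (Iio_mem_nhds hpos)] with ρ hρ _ using Or.inr hρ
    · exact Eventually.of_forall fun ρ hT => Or.inl (by tauto)
  obtain ⟨ρ, hρ, hpos⟩ := (key.and self_mem_nhdsWithin).exists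
  exact ⟨ρ, hpos, hρ⟩

/-- The isometries carrying the sets of a family into `L` keep all differences in `L`. -/
lemma exists_isometry_lcDiffSet_subset {d : ℕ} (L : AddSubgroup (Euc d)) :
    ∃ I : Set (Euc d) → (Euc d ≃ᵢ Euc d),
      lcDiffSet {X : Set (Euc d) | ∃ f : Euc d ≃ᵢ Euc d, f '' X ⊆ (L : Set (Euc d))} I ⊆ L := by
  have hI : ∀ X : Set (Euc d), ∃ g : Euc d ≃ᵢ Euc d,
      (∃ f : Euc d ≃ᵢ Euc d, f '' X ⊆ (L : Set (Euc d))) → g '' X ⊆ (L : Set (Euc d)) := by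
    intro X
    by_cases h : ∃ f : Euc d ≃ᵢ Euc d, f '' X ⊆ (L : Set (Euc d))
    · obtain ⟨f, hf⟩ := h
      exact ⟨f, fun _ => hf⟩
    · exact ⟨IsometryEquiv.refl _, fun h' => absurd h' h⟩
  choose I hI using hI
  refine ⟨I, ?_⟩
  rintro z ⟨X, hX, x, hx, y, hy, rfl⟩
  exact L.sub_mem (hI X hX (mem_image_of_mem _ hx)) (hI X hX (mem_image_of_mem _ hy))

/-- Subsets of a fixed lattice satisfy the second condition of limited complexity. -/
lemma IsLattice.exists_lcCondII {d : ℕ} {L : AddSubgroup (Euc d)} (hL : IsLattice L) :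
    ∃ ρ > 0, LCCondII
      {X : Set (Euc d) | ∃ f : Euc d ≃ᵢ Euc d, f '' X ⊆ (L : Set (Euc d))} ρ := by
  obtain ⟨ρ, hρ, h⟩ :=
    exists_pos_forall_lt_infDist_affineSpan (hL.finite_inter_closedBall 1) (0 : Euc d)
  refine ⟨ρ, hρ, ?_⟩
  rintro X ⟨f, hf⟩ x hx S hS hne
  let g : Euc d ≃ᵃⁱ[ℝ] Euc d := (f.trans (IsometryEquiv.subRight (f x))).toRealAffineIsometryEquiv
  have hg : ∀ y, g y = f y - f x := fun y => rfl
  have hgx : g x = 0 := by rw [hg, sub_self]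
  have himage : g '' (affineSpan ℝ S : Set (Euc d)) = affineSpan ℝ (g '' S) := by
    have := AffineSubspace.map_span (g.toAffineEquiv : Euc d →ᵃ[ℝ] Euc d) S
    exact congrArg (fun A : AffineSubspace ℝ (Euc d) => (A : Set (Euc d))) this
  have hsub : g '' S ⊆ (L : Set (Euc d)) ∩ closedBall 0 1 := by
    rintro _ ⟨y, hy, rfl⟩
    refine ⟨?_, ?_⟩
    · rw [hg]
      exact L.sub_mem (hf (mem_image_of_mem _ (hS hy).1)) (hf (mem_image_of_mem _ hx))
    · rw [mem_closedBall, ← hgx, g.isometry.dist_eq, dist_comm]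
      exact (hS hy).2.le
  rcases h _ hsub (hne.image _) with h0 | h0
  · left
    rw [← SetLike.mem_coe, ← himage, ← hgx] at h0
    exact (g.injective.mem_set_image).1 h0
  · right
    rwa [← himage, ← hgx, infDist_image g.isometry] at h0

/-- For a lattice `Λ ⊆ ℝ^d` of minimum distance at least 1, the family of
all packing sets isometric to a subset of `Λ` is of limited complexity; moreover the
isometries in condition (i) can be chosen so that the difference set is finite in any
bounded region. -/
theorem isLCFamily_of_subsets_of_fixed_lattice
    (d : ℕ) (hd : 2 ≤ d) (L : AddSubgroup (Euc d)) (hL : IsLattice L)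
    (hmin : ∀ x ∈ L, ∀ y ∈ L, x ≠ y → 1 ≤ dist x y) :
    IsLCFamily {X : Set (Euc d) | ∃ f : Euc d ≃ᵢ Euc d, f '' X ⊆ (L : Set (Euc d))} ∧
    ∃ I : Set (Euc d) → (Euc d ≃ᵢ Euc d), ∀ R : ℝ, 0 < R →
      (lcDiffSet {X : Set (Euc d) | ∃ f : Euc d ≃ᵢ Euc d, f '' X ⊆ (L : Set (Euc d))} I ∩
        closedBall 0 R).Finite := by
  obtain ⟨I, hI⟩ := exists_isometry_lcDiffSet_subset L
  have hfin : ∀ R : ℝ, 0 < R → (lcDiffSet {X : Set (Euc d) |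
      ∃ f : Euc d ≃ᵢ Euc d, f '' X ⊆ (L : Set (Euc d))} I ∩ closedBall 0 R).Finite :=
    fun R _ => (hL.finite_inter_closedBall R).subset (inter_subset_inter_left _ hI)
  refine ⟨⟨?_, ⟨I, fun R _ => ?_⟩, hL.exists_lcCondII⟩, I, hfin⟩
  · rintro X ⟨f, hf⟩ x hx y hy hxy
    have := hmin _ (hf (mem_image_of_mem f hx)) _ (hf (mem_image_of_mem f hy))
      (f.injective.ne hxy)
    rwa [f.isometry.dist_eq] at this
  · refine finite_empty.subset ?_
    rintro p ⟨_, hp⟩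
    exact not_accPt_of_finite_inter_closedBall hfin p hp
end
end
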